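/- Let n ≥ 1, m ≥ 1, 0 < p < ∞ and s_1,…,s_m > −1, and set λ = (m−1)(n+1) + s_1 + ⋯ + s_m. Then there is a constant C > 0 such that for every function f harmonic on (ℝ^{n+1}_+)^m one has ∫_{ℝ^{n+1}_+} |f(z,…,z)|^p dm_λ(z) ≤ C ∫_{ℝ^{n+1}_+}⋯∫_{ℝ^{n+1}_+} |f(z_1,…,z_m)|^p dm_{s_1}(z_1)⋯dm_{s_m}(z_m). -/

import Mathlib

open MeasureTheory Real Set
open scoped ENNReal

noncomputable section

abbrev Euc (N : ℕ) : Type := EuclideanSpace ℝ (Fin N)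

/-- The point `(x, t) ∈ ℝ^{n+1}`. -/
def pt {n : ℕ} (x : Euc n) (t : ℝ) : Euc (n + 1) :=
  (EuclideanSpace.equiv (Fin (n + 1)) ℝ).symm (Fin.snoc (fun i => x i) t)

/-- horizontal part of a point of ℝ^{n+1} -/
def xp {n : ℕ} (z : Euc (n + 1)) : Euc n :=
  (EuclideanSpace.equiv (Fin n) ℝ).symm (fun i => z i.castSucc)

/-- vertical part of a point of ℝ^{n+1} -/
def tp {n : ℕ} (z : Euc (n + 1)) : ℝ := z (Fin.last n)

/-- The upper half space ℝ^{n+1}_+. -/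
def upperHS (n : ℕ) : Set (Euc (n + 1)) := {z | 0 < tp z}

/-- |z - w̄| where z = (x,t), w̄ = (y, -s): Euclidean distance -/
def dB {n : ℕ} (x : Euc n) (t : ℝ) (y : Euc n) (s : ℝ) : ℝ :=
  dist (pt x t) (pt y (-s))

/-- the measure t^λ dx dt on ℝ^n × (0,∞), identified with ℝ^{n+1}_+ -/
def mLam (n : ℕ) (l : ℝ) : Measure (Euc n × ℝ) :=
  ((volume : Measure (Euc n)).prod ((volume : Measure ℝ).restrict (Ioi 0))).withDensity
    (fun zt => ENNReal.ofReal (zt.2 ^ l))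

/-- second derivative of `f` at `z` along direction `v` -/
def d2 {V : Type*} [NormedAddCommGroup V] [NormedSpace ℝ V] (f : V → ℝ) (z v : V) : ℝ :=
  iteratedFDeriv ℝ 2 f z ![v, v]

/-- `f` is harmonic on a subset of ℝ^N : twice continuously differentiable with
vanishing Laplacian. -/
def HarmonicOnE {N : ℕ} (f : Euc N → ℝ) (s : Set (Euc N)) : Prop :=
  ContDiffOn ℝ 2 f s ∧ ∀ z ∈ s, ∑ i, d2 f z (EuclideanSpace.single i 1) = 0

/-- `f` is harmonic on (ℝ^{n+1}_+)^m, viewed as an open subset of ℝ^{m(n+1)}. -/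
def HarmonicOnM {n m : ℕ} (f : (Fin m → Euc (n + 1)) → ℝ) : Prop :=
  ContDiffOn ℝ 2 f {z | ∀ j, z j ∈ upperHS n} ∧
  ∀ z ∈ {z : Fin m → Euc (n + 1) | ∀ j, z j ∈ upperHS n},
    ∑ j, ∑ i, d2 f z (Function.update (0 : Fin m → Euc (n + 1)) j (EuclideanSpace.single i 1)) = 0

/-- `f` is harmonic in each variable separately on (ℝ^{n+1}_+)^m -/
def HarmonicSep {n m : ℕ} (f : (Fin m → Euc (n + 1)) → ℝ) : Prop :=
  ∀ (j : Fin m) (z : Fin m → Euc (n + 1)), (∀ k, z k ∈ upperHS n) →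
    HarmonicOnE (fun w => f (Function.update z j w)) (upperHS n)

/-- the closed cube centered at (y,s) with side length s -/
def Qcube {n : ℕ} (y : Euc n) (s : ℝ) : Set (Euc (n + 1)) :=
  {z | (∀ i : Fin n, |z (Fin.castSucc i) - y i| ≤ s / 2) ∧ |tp z - s| ≤ s / 2}

/-- the A^p_λ (quasi)-norm, raised to the power p -/
def normAp (n : ℕ) (f : Euc (n + 1) → ℝ) (p l : ℝ) : ℝ≥0∞ :=
  ∫⁻ zt : Euc n × ℝ, ENNReal.ofReal (|f (pt zt.1 zt.2)| ^ p) ∂(mLam n l)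

/-- membership in the harmonic Bergman space A^p_λ -/
def memAp (n : ℕ) (f : Euc (n + 1) → ℝ) (p l : ℝ) : Prop :=
  HarmonicOnE f (upperHS n) ∧ normAp n f p l < ⊤


section MeanValue

lemma hasDerivAt_max_zero_pow (k : ℕ) (s : ℝ) :
    HasDerivAt (fun s : ℝ => (max 0 s) ^ (k + 2)) ((k + 2) * (max 0 s) ^ (k + 1)) s := by
  rcases lt_trichotomy s 0 with h | rfl | h
  · have : (fun s : ℝ => (max 0 s) ^ (k + 2)) =ᶠ[nhds s] fun _ => 0 := by
      filter_upwards [Iio_mem_nhds h] with x hx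
      rw [max_eq_left (le_of_lt hx)]; simp
    rw [max_eq_left h.le]
    simpa using (hasDerivAt_const s (0 : ℝ)).congr_of_eventuallyEq this
  · rw [hasDerivAt_iff_isLittleO]
    have : (fun x : ℝ => x ^ (k + 2)) =o[nhds 0] fun x : ℝ => x := by
      simpa using Asymptotics.isLittleO_pow_pow (𝕜 := ℝ) (m := 1) (n := k + 2) (by omega)
    refine (Asymptotics.IsBigO.of_bound 1 (Filter.Eventually.of_forall fun x => ?_)).trans_isLittleO
      (this.congr_right fun x => by simp)
    rcases le_total x 0 with hx | hx
    · simp [hx]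
    · simp [hx]
  · have : (fun s : ℝ => (max 0 s) ^ (k + 2)) =ᶠ[nhds s] fun s => s ^ (k + 2) := by
      filter_upwards [Ioi_mem_nhds h] with x hx
      rw [max_eq_right (le_of_lt hx)]
    rw [max_eq_right h.le]
    simpa using (hasDerivAt_pow (k + 2) s).congr_of_eventuallyEq this

variable {V ι : Type*} [NormedAddCommGroup V] [NormedSpace ℝ V] [FiniteDimensional ℝ V]
  [Fintype ι]

/-- The sum of the squares of the coordinates with respect to a basis. -/
def coordSq (b : Module.Basis ι ℝ V) (y : V) : ℝ := ∑ i, (b.coord i).toContinuousLinearMap y ^ 2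

/-- The function `(1 - |y|²)₊ ^ k`, with `|y|` the Euclidean norm in the coordinates of `b`. -/
def radialBump (b : Module.Basis ι ℝ V) (k : ℕ) (y : V) : ℝ := max 0 (1 - coordSq b y) ^ k

variable (b : Module.Basis ι ℝ V)

lemma continuous_coordSq : Continuous (coordSq b) := by
  unfold coordSq; fun_prop

lemma continuous_radialBump (k : ℕ) : Continuous (radialBump b k) := by
  have := continuous_coordSq b
  unfold radialBump; fun_prop

lemma coordSq_nonneg (y : V) : 0 ≤ coordSq b y := Finset.sum_nonneg fun _ _ => sq_nonneg _

lemma radialBump_nonneg (k : ℕ) (y : V) : 0 ≤ radialBump b k y := by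
  unfold radialBump; positivity

lemma radialBump_le_one (k : ℕ) (y : V) : radialBump b k y ≤ 1 := by
  refine pow_le_one₀ (le_max_left _ _) (max_le zero_le_one ?_)
  linarith [coordSq_nonneg b y]

variable {b}

lemma radialBump_eq_zero (hb : ∀ y, ‖y‖ ^ 2 ≤ coordSq b y) {k : ℕ} (hk : k ≠ 0) {y : V}
    (hy : 1 ≤ ‖y‖) : radialBump b k y = 0 := by
  have : 1 - coordSq b y ≤ 0 := by nlinarith [hb y]
  simp [radialBump, max_eq_left this, hk]

lemma hasCompactSupport_radialBump (hb : ∀ y, ‖y‖ ^ 2 ≤ coordSq b y) {k : ℕ} (hk : k ≠ 0) :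
    HasCompactSupport (radialBump b k) := by
  refine HasCompactSupport.of_support_subset_isCompact (isCompact_closedBall (0 : V) 1) ?_
  intro y hy
  by_contra h
  refine hy (radialBump_eq_zero hb hk ?_)
  simp only [mem_closedBall_zero_iff, not_le] at h
  exact h.le

lemma hasFDerivAt_radialBump (k : ℕ) (y : V) :
    HasFDerivAt (radialBump b (k + 2))
      ((-(2 * (k + 2) * radialBump b (k + 1) y)) •
        ∑ i, (b.coord i).toContinuousLinearMap y • (b.coord i).toContinuousLinearMap) y := by
  have h1 : HasFDerivAt (coordSq b)
      (∑ i, (2 * (b.coord i).toContinuousLinearMap y) • (b.coord i).toContinuousLinearMap) y := by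
    unfold coordSq
    refine HasFDerivAt.fun_sum fun i _ => ?_
    simpa using ((b.coord i).toContinuousLinearMap.hasFDerivAt (x := y)).pow 2
  have h2 := (hasDerivAt_max_zero_pow k (1 - coordSq b y)).comp_hasFDerivAt y (h1.const_sub 1)
  refine h2.congr_fderiv ?_
  ext v
  simp only [radialBump, smul_apply, neg_apply,
    sum_apply, smul_eq_mul, mul_assoc, ← Finset.mul_sum]
  ring

lemma fderiv_radialBump_basis (k : ℕ) (y : V) (i : ι) :
    fderiv ℝ (radialBump b (k + 2)) y (b i) =
      -(2 * (k + 2)) * (b.coord i y * radialBump b (k + 1) y) := by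
  classical
  rw [(hasFDerivAt_radialBump k y).fderiv]
  simp [Finsupp.single_apply]
  ring

variable [MeasurableSpace V] [BorelSpace V] {μ : Measure V} [μ.IsAddHaarMeasure]

lemma integral_radialBump_pos (hb : ∀ y, ‖y‖ ^ 2 ≤ coordSq b y) {k : ℕ} (hk : k ≠ 0) :
    0 < ∫ y, radialBump b k y ∂μ := by
  refine (continuous_radialBump b k).integral_pos_of_hasCompactSupport_nonneg_nonzero
    (hasCompactSupport_radialBump hb hk) (radialBump_nonneg b k) (x := 0) ?_
  simp [radialBump, coordSq]

lemma hasDerivAt_integral_radialBump (hb : ∀ y, ‖y‖ ^ 2 ≤ coordSq b y) {f : V → ℝ}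
    (hf : ContDiff ℝ 2 f) (z : V) (t : ℝ) :
    HasDerivAt (fun t : ℝ => ∫ y, f (z + t • y) * radialBump b 2 y ∂μ)
      (∫ y, fderiv ℝ f (z + t • y) y * radialBump b 2 y ∂μ) t := by
  have hφ := continuous_radialBump b 2
  have hφc := hasCompactSupport_radialBump (k := 2) hb (by norm_num)
  have hf0 : Continuous f := hf.continuous
  have hf1 : Continuous (fderiv ℝ f) := hf.continuous_fderiv (by norm_num)
  have hG : Continuous fun w : ℝ × V => fderiv ℝ f (z + w.1 • w.2) w.2 := by fun_prop
  obtain ⟨K, hK⟩ := ((isCompact_closedBall t 1).prod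
    (isCompact_closedBall (0 : V) 1)).exists_bound_of_continuousOn hG.continuousOn
  refine (hasDerivAt_integral_of_dominated_loc_of_deriv_le (μ := μ) (s := Metric.closedBall t 1)
    (F := fun t y => f (z + t • y) * radialBump b 2 y)
    (F' := fun t y => fderiv ℝ f (z + t • y) y * radialBump b 2 y)
    (bound := fun y => K * radialBump b 2 y) (Metric.closedBall_mem_nhds t one_pos)
    (Filter.Eventually.of_forall fun t' => ?_) ?_ ?_ ?_ ?_ ?_).2
  · exact Continuous.aestronglyMeasurable (by fun_prop)
  · exact Continuous.integrable_of_hasCompactSupport (by fun_prop) hφc.mul_left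
  · exact Continuous.aestronglyMeasurable (by fun_prop)
  · refine Filter.Eventually.of_forall fun y t' ht' => ?_
    by_cases hy : 1 ≤ ‖y‖
    · simp [radialBump_eq_zero hb two_ne_zero hy]
    · rw [norm_mul, Real.norm_of_nonneg (radialBump_nonneg b 2 y)]
      refine mul_le_mul_of_nonneg_right (hK (t', y) ⟨ht', ?_⟩) (radialBump_nonneg b 2 y)
      simpa using (not_le.1 hy).le
  · exact Continuous.integrable_of_hasCompactSupport (by fun_prop) hφc.mul_left
  · refine Filter.Eventually.of_forall fun y t' _ => ?_
    have h1 : HasDerivAt (fun t : ℝ => z + t • y) y t' := by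
      simpa using ((hasDerivAt_id t').smul_const y).const_add z
    have h2 := ((hf.differentiable (by norm_num)) (z + t' • y)).hasFDerivAt.comp_hasDerivAt t' h1
    exact h2.mul_const _

lemma integral_fderiv_mul_radialBump_eq_zero (hb : ∀ y, ‖y‖ ^ 2 ≤ coordSq b y) {f : V → ℝ}
    (hf : ContDiff ℝ 2 f) (z : V) (t : ℝ)
    (h : ∀ y : V, ‖y‖ < 1 → ∑ i, fderiv ℝ (fderiv ℝ f) (z + t • y) (b i) (b i) = 0) :
    ∫ y, fderiv ℝ f (z + t • y) y * radialBump b 2 y ∂μ = 0 := by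
  have hφ := continuous_radialBump b 2
  have hφc := hasCompactSupport_radialBump (k := 2) hb (by norm_num)
  have hψ := continuous_radialBump b 3
  have hψc := hasCompactSupport_radialBump (k := 3) hb (by norm_num)
  have hf1 : ContDiff ℝ 1 (fderiv ℝ f) := hf.fderiv_right (by norm_num)
  have hf1c : Continuous (fderiv ℝ f) := hf1.continuous
  have hf2c : Continuous (fderiv ℝ (fderiv ℝ f)) := hf1.continuous_fderiv (by norm_num)
  have hcoord (i : ι) : Continuous (b.coord i) := (b.coord i).continuous_of_finiteDimensional
  have hderiv (i : ι) (y : V) : HasFDerivAt (fun y => fderiv ℝ f (z + t • y) (b i))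
      (t • (fderiv ℝ (fderiv ℝ f) (z + t • y)).flip (b i)) y := by
    have h1 : HasFDerivAt (fun y : V => z + t • y) (t • ContinuousLinearMap.id ℝ V) y :=
      ((hasFDerivAt_id y).const_smul t).const_add z
    have h2 := ((hf1.differentiable (by norm_num)) (z + t • y)).hasFDerivAt.comp y h1
    refine (h2.clm_apply (hasFDerivAt_const (b i) y)).congr_fderiv ?_
    ext v; simp
  have hparts (i : ι) : ∫ y, fderiv ℝ f (z + t • y) (b i) * fderiv ℝ (radialBump b 3) y (b i) ∂μ =
      - ∫ y, fderiv ℝ (fun y => fderiv ℝ f (z + t • y) (b i)) y (b i) * radialBump b 3 y ∂μ := by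
    refine integral_mul_fderiv_eq_neg_fderiv_mul_of_integrable ?_ ?_ ?_
      (fun x _ => (hderiv i x).differentiableAt)
      (fun x _ => (hasFDerivAt_radialBump 1 x).differentiableAt)
    · simp_rw [(hderiv i _).fderiv]
      refine Continuous.integrable_of_hasCompactSupport ?_ hψc.mul_left
      simp only [smul_apply, ContinuousLinearMap.flip_apply]
      fun_prop
    · simp_rw [fderiv_radialBump_basis 1]
      refine Continuous.integrable_of_hasCompactSupport ?_
        (HasCompactSupport.mul_left (HasCompactSupport.mul_left hφc.mul_left))
      have := hcoord i
      fun_prop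
    · exact Continuous.integrable_of_hasCompactSupport (by fun_prop) hψc.mul_left
  have hint (i : ι) : Integrable
      (fun y => fderiv ℝ f (z + t • y) (b i) * (b.coord i y * radialBump b 2 y)) μ := by
    refine Continuous.integrable_of_hasCompactSupport ?_
        (HasCompactSupport.mul_left hφc.mul_left)
    have := hcoord i
    fun_prop
  have hint' (i : ι) : Integrable
      (fun y => fderiv ℝ (fderiv ℝ f) (z + t • y) (b i) (b i) * radialBump b 3 y) μ :=
    Continuous.integrable_of_hasCompactSupport (by fun_prop) hψc.mul_left
  have hi (i : ι) : ∫ y, fderiv ℝ f (z + t • y) (b i) * (b.coord i y * radialBump b 2 y) ∂μ =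
      (t / 6) * ∫ y, fderiv ℝ (fderiv ℝ f) (z + t • y) (b i) (b i) * radialBump b 3 y ∂μ := by
    have := hparts i
    simp_rw [(hderiv i _).fderiv, fderiv_radialBump_basis 1] at this
    simp_rw [mul_left_comm _ (-(2 * _) : ℝ), smul_apply, ContinuousLinearMap.flip_apply,
      smul_eq_mul, mul_assoc, integral_const_mul] at this
    norm_num at this
    simp only [Module.Basis.coord_apply]
    linarith
  calc ∫ y, fderiv ℝ f (z + t • y) y * radialBump b 2 y ∂μ
      = ∫ y, ∑ i, fderiv ℝ f (z + t • y) (b i) * (b.coord i y * radialBump b 2 y) ∂μ := by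
        congr 1; ext y
        have : fderiv ℝ f (z + t • y) y = ∑ i, b.coord i y * fderiv ℝ f (z + t • y) (b i) := by
          conv_lhs => enter [2]; rw [← b.sum_repr y]
          simp only [map_sum, map_smul, smul_eq_mul, Module.Basis.coord_apply]
        rw [this, Finset.sum_mul]
        refine Finset.sum_congr rfl fun i _ => ?_
        ring
    _ = (t / 6) * ∫ y, (∑ i, fderiv ℝ (fderiv ℝ f) (z + t • y) (b i) (b i)) *
          radialBump b 3 y ∂μ := by
        rw [integral_finsetSum _ fun i _ => hint i]
        simp_rw [hi, ← Finset.mul_sum, Finset.sum_mul]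
        rw [integral_finsetSum _ fun i _ => hint' i]
    _ = 0 := by
        rw [integral_eq_zero_of_ae, mul_zero]
        refine Filter.Eventually.of_forall fun y => ?_
        rcases le_or_gt 1 ‖y‖ with hy | hy
        · simp [radialBump_eq_zero hb three_ne_zero hy]
        · simp [h y hy]

/-- The mean value property against a radial weight, for globally `C²` functions. -/
lemma mul_integral_radialBump_eq (hb : ∀ y, ‖y‖ ^ 2 ≤ coordSq b y) {f : V → ℝ}
    (hf : ContDiff ℝ 2 f) {z : V} {r : ℝ} (hr : 0 ≤ r)
    (h : ∀ x ∈ Metric.ball z r, ∑ i, fderiv ℝ (fderiv ℝ f) x (b i) (b i) = 0) :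
    f z * ∫ y, radialBump b 2 y ∂μ = ∫ y, f (z + r • y) * radialBump b 2 y ∂μ := by
  have hd := hasDerivAt_integral_radialBump (μ := μ) hb hf z
  have := constant_of_has_deriv_right_zero (a := 0) (b := r)
    (f := fun t : ℝ => ∫ y, f (z + t • y) * radialBump b 2 y ∂μ)
    (fun t _ => (hd t).continuousAt.continuousWithinAt) (fun t ht => ?_) r ⟨hr, le_rfl⟩
  · simpa [integral_const_mul] using this.symm
  · rw [← integral_fderiv_mul_radialBump_eq_zero (μ := μ) hb hf z t]
    · exact (hd t).hasDerivWithinAt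
    · intro y hy
      apply h
      have : ‖t • y‖ < r := by
        rw [norm_smul, Real.norm_of_nonneg ht.1]
        nlinarith [ht.1, ht.2, norm_nonneg y]
      simpa using this

end MeanValue

section LocalEstimate

variable {V ι : Type*} [NormedAddCommGroup V] [NormedSpace ℝ V] [FiniteDimensional ℝ V]
  [Fintype ι] {b : Module.Basis ι ℝ V}

lemma exists_contDiff_eq_on_closedBall {f : V → ℝ} {z : V} {r : ℝ} (hr : 0 < r)
    (hf : ContDiffOn ℝ 2 f (Metric.ball z (2 * r))) :
    ∃ g : V → ℝ, ContDiff ℝ 2 g ∧ ∀ x ∈ Metric.closedBall z r, g x = f x := by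
  let χ : ContDiffBump z := ⟨r, 3 / 2 * r, hr, by linarith⟩
  refine ⟨fun x => χ x * f x, contDiff_iff_contDiffAt.2 fun x => ?_, fun x hx => ?_⟩
  · by_cases hx : x ∈ Metric.ball z (2 * r)
    · exact χ.contDiffAt.mul (hf.contDiffAt (Metric.isOpen_ball.mem_nhds hx))
    · have hx' : x ∉ tsupport χ := by
        rw [χ.tsupport_eq]
        simp only [Metric.mem_ball, not_lt, Metric.mem_closedBall, not_le, χ] at hx ⊢
        linarith
      have : (fun x => χ x * f x) =ᶠ[nhds x] fun _ => 0 := by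
        filter_upwards [notMem_tsupport_iff_eventuallyEq.1 hx'] with y hy
        simp [hy]
      exact contDiffAt_const.congr_of_eventuallyEq this
  · simp [χ.one_of_mem_closedBall hx]

variable [MeasurableSpace V] [BorelSpace V] {μ : Measure V} [μ.IsAddHaarMeasure]

lemma setIntegral_ball_comp_affine (F : V → ℝ) (z : V) {r : ℝ} (hr : 0 < r) :
    ∫ y in Metric.ball (0 : V) 1, F (z + r • y) ∂μ =
      (r ^ Module.finrank ℝ V)⁻¹ * ∫ y in Metric.ball z r, F y ∂μ := by
  rw [Measure.setIntegral_comp_smul_of_pos μ (fun v => F (z + v)) _ hr, smul_unitBall hr.ne',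
    Real.norm_of_nonneg hr.le, smul_eq_mul]
  have := (measurePreserving_add_left μ z).setIntegral_preimage_emb
    (Homeomorph.addLeft z).measurableEmbedding F (Metric.ball z r)
  rw [← this]
  simp

/-- The `L¹` sub-mean value property of harmonic functions. -/
lemma mul_abs_le_setIntegral_ball (hb : ∀ y, ‖y‖ ^ 2 ≤ coordSq b y) {f : V → ℝ} {z : V} {r : ℝ}
    (hr : 0 < r) (hf : ContDiffOn ℝ 2 f (Metric.ball z (2 * r)))
    (h : ∀ x ∈ Metric.ball z (2 * r), ∑ i, fderiv ℝ (fderiv ℝ f) x (b i) (b i) = 0) :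
    (∫ y, radialBump b 2 y ∂μ) * r ^ Module.finrank ℝ V * |f z| ≤
      ∫ y in Metric.ball z r, |f y| ∂μ := by
  obtain ⟨g, hg, hgf⟩ := exists_contDiff_eq_on_closedBall hr hf
  have hgh : ∀ x ∈ Metric.ball z r, ∑ i, fderiv ℝ (fderiv ℝ g) x (b i) (b i) = 0 := by
    intro x hx
    have : g =ᶠ[nhds x] f := by
      filter_upwards [Metric.isOpen_ball.mem_nhds hx] with y hy
      exact hgf y (Metric.ball_subset_closedBall hy)
    rw [this.fderiv.fderiv_eq]
    exact h x (Metric.ball_subset_ball (by linarith) hx)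
  have hmean := mul_integral_radialBump_eq (μ := μ) hb hg hr.le hgh
  have hpos := integral_radialBump_pos (μ := μ) hb two_ne_zero
  have hφ := continuous_radialBump b 2
  have hgc := hg.continuous
  have hle : (∫ y, radialBump b 2 y ∂μ) * |f z| ≤
      ∫ y in Metric.ball (0 : V) 1, |g (z + r • y)| ∂μ := by
    have hball : ∫ y in Metric.ball (0 : V) 1, g (z + r • y) * radialBump b 2 y ∂μ =
        ∫ y, g (z + r • y) * radialBump b 2 y ∂μ :=
      setIntegral_eq_integral_of_forall_compl_eq_zero fun y hy => by
        rw [radialBump_eq_zero hb two_ne_zero (by simpa using hy), mul_zero]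
    have hint {F : V → ℝ} (hF : Continuous F) : IntegrableOn F (Metric.ball (0 : V) 1) μ :=
      (hF.continuousOn.integrableOn_compact (isCompact_closedBall (0 : V) 1)).mono_set
        Metric.ball_subset_closedBall
    calc (∫ y, radialBump b 2 y ∂μ) * |f z|
        = |∫ y in Metric.ball (0 : V) 1, g (z + r • y) * radialBump b 2 y ∂μ| := by
          rw [hball, ← hmean, abs_mul, abs_of_pos hpos, hgf z (by simp [hr.le]), mul_comm]
      _ ≤ ∫ y in Metric.ball (0 : V) 1, |g (z + r • y) * radialBump b 2 y| ∂μ :=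
          abs_integral_le_integral_abs
      _ ≤ ∫ y in Metric.ball (0 : V) 1, |g (z + r • y)| ∂μ := by
          refine setIntegral_mono_on (hint (by fun_prop)) (hint (by fun_prop)) measurableSet_ball
            fun y _ => ?_
          rw [abs_mul, abs_of_nonneg (radialBump_nonneg b 2 y)]
          exact mul_le_of_le_one_right (abs_nonneg _) (radialBump_le_one b 2 y)
  rw [setIntegral_ball_comp_affine (fun v => |g v|) z hr, inv_mul_eq_div,
    le_div_iff₀ (by positivity)] at hle
  calc _ = (∫ y, radialBump b 2 y ∂μ) * |f z| * r ^ Module.finrank ℝ V := by ring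
    _ ≤ ∫ y in Metric.ball z r, |g y| ∂μ := hle
    _ = ∫ y in Metric.ball z r, |f y| ∂μ :=
        setIntegral_congr_fun measurableSet_ball fun y hy => by
          simp only [hgf y (Metric.ball_subset_closedBall hy)]

lemma integrableOn_abs_rpow_ball {f : V → ℝ} {z : V} {r p : ℝ} (hp : 0 ≤ p)
    (hf : ContinuousOn f (Metric.closedBall z r)) :
    IntegrableOn (fun y => |f y| ^ p) (Metric.ball z r) μ :=
  ((hf.abs.rpow_const fun _ _ => Or.inr hp).integrableOn_compact
    (isCompact_closedBall z r)).mono_set Metric.ball_subset_closedBall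

lemma exists_rpow_le_of_one_le (hb : ∀ y, ‖y‖ ^ 2 ≤ coordSq b y) {p : ℝ} (hp : 1 ≤ p) :
    ∃ C : ℝ, 0 < C ∧ ∀ (f : V → ℝ) (z : V) (r : ℝ), 0 < r →
      ContDiffOn ℝ 2 f (Metric.ball z (2 * r)) →
      (∀ x ∈ Metric.ball z (2 * r), ∑ i, fderiv ℝ (fderiv ℝ f) x (b i) (b i) = 0) →
      r ^ Module.finrank ℝ V * |f z| ^ p ≤ C * ∫ y in Metric.ball z r, |f y| ^ p ∂μ := by
  set A := ∫ y, radialBump b 2 y ∂μ with hA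
  have hA0 : 0 < A := integral_radialBump_pos hb two_ne_zero
  set β := μ.real (Metric.ball (0 : V) 1) with hβ
  have hβ0 : 0 < β := ENNReal.toReal_pos (Metric.measure_ball_pos μ _ one_pos).ne'
    measure_ball_lt_top.ne
  refine ⟨(A / 2 * (A / (2 * β)) ^ (p - 1))⁻¹, by positivity, fun f z r hr hf h => ?_⟩
  have hfc : ContinuousOn f (Metric.closedBall z r) :=
    hf.continuousOn.mono (Metric.closedBall_subset_ball (by linarith))
  rw [inv_mul_eq_div, le_div_iff₀ (by positivity)]
  have hI : 0 ≤ ∫ y in Metric.ball z r, |f y| ^ p ∂μ :=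
    setIntegral_nonneg measurableSet_ball fun y _ => by positivity
  rcases eq_or_ne (f z) 0 with h0 | h0
  · rw [h0, abs_zero, Real.zero_rpow (by linarith)]; simpa using hI
  have hfz : 0 < |f z| := abs_pos.2 h0
  set ε := A / (2 * β) * |f z| with hε
  have hε0 : 0 < ε := by positivity
  have hpt (a : ℝ) (ha : 0 ≤ a) : a ≤ ε + ε ^ (1 - p) * a ^ p := by
    rcases le_or_gt a ε with hle | hlt
    · have : 0 ≤ ε ^ (1 - p) * a ^ p := by positivity
      linarith
    · have h1 : ε ^ (p - 1) ≤ a ^ (p - 1) := Real.rpow_le_rpow hε0.le hlt.le (by linarith)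
      have h2 : a ^ p = a * a ^ (p - 1) := by
        rw [← Real.rpow_one_add' ha (by linarith)]; congr 1; ring
      have h3 : ε ^ (1 - p) * ε ^ (p - 1) = 1 := by
        rw [← Real.rpow_add hε0]; simp
      have h4 : a ≤ ε ^ (1 - p) * a ^ p := by
        calc a = ε ^ (1 - p) * (a * ε ^ (p - 1)) := by rw [mul_left_comm, h3, mul_one]
          _ ≤ ε ^ (1 - p) * a ^ p := by rw [h2]; gcongr
      linarith
  have hle : ∫ y in Metric.ball z r, |f y| ∂μ ≤
      ε * (r ^ Module.finrank ℝ V * β) + ε ^ (1 - p) * ∫ y in Metric.ball z r, |f y| ^ p ∂μ := by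
    have hint := integrableOn_abs_rpow_ball (μ := μ) (p := p) (by linarith) hfc
    have hconst : IntegrableOn (fun _ => ε) (Metric.ball z r) μ :=
      integrableOn_const measure_ball_lt_top.ne
    have hvol : μ.real (Metric.ball z r) = r ^ Module.finrank ℝ V * β := by
      rw [Measure.real, Measure.addHaar_ball_of_pos _ _ hr, ENNReal.toReal_mul,
        ENNReal.toReal_ofReal (by positivity)]
      rfl
    calc ∫ y in Metric.ball z r, |f y| ∂μ
        ≤ ∫ y in Metric.ball z r, (ε + ε ^ (1 - p) * |f y| ^ p) ∂μ :=
          setIntegral_mono_on (by simpa using integrableOn_abs_rpow_ball (p := 1) zero_le_one hfc)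
            (hconst.add (hint.const_mul _)) measurableSet_ball fun y _ => hpt _ (abs_nonneg _)
      _ = _ := by
          rw [integral_add hconst (hint.const_mul _), setIntegral_const, integral_const_mul,
            smul_eq_mul, hvol, mul_comm ε]
  have hmain := (mul_abs_le_setIntegral_ball (μ := μ) hb hr hf h).trans hle
  have h5 : ε * (r ^ Module.finrank ℝ V * β) = A / 2 * r ^ Module.finrank ℝ V * |f z| := by
    rw [hε]; field_simp
  have h6 : A / 2 * r ^ Module.finrank ℝ V * |f z| ≤
      ε ^ (1 - p) * ∫ y in Metric.ball z r, |f y| ^ p ∂μ := by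
    rw [h5] at hmain; linarith
  have h7 : ε ^ (p - 1) * ε ^ (1 - p) = 1 := by
    rw [← Real.rpow_add hε0]; simp
  calc r ^ Module.finrank ℝ V * |f z| ^ p * (A / 2 * (A / (2 * β)) ^ (p - 1))
      = ε ^ (p - 1) * (A / 2 * r ^ Module.finrank ℝ V * |f z|) := by
        rw [hε, Real.mul_rpow (by positivity) (abs_nonneg _)]
        have : |f z| ^ p = |f z| ^ (p - 1) * |f z| := by
          rw [← Real.rpow_add_one hfz.ne']; simp
        rw [this]; ring
    _ ≤ ε ^ (p - 1) * (ε ^ (1 - p) * ∫ y in Metric.ball z r, |f y| ^ p ∂μ) := by gcongr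
    _ = _ := by rw [← mul_assoc, h7, one_mul]

lemma exists_rpow_le_of_lt_one [Nontrivial V] (hb : ∀ y, ‖y‖ ^ 2 ≤ coordSq b y) {p : ℝ}
    (hp : 0 < p) (hp1 : p < 1) :
    ∃ C : ℝ, 0 < C ∧ ∀ (f : V → ℝ) (z : V) (r : ℝ), 0 < r →
      ContDiffOn ℝ 2 f (Metric.ball z (2 * r)) →
      (∀ x ∈ Metric.ball z (2 * r), ∑ i, fderiv ℝ (fderiv ℝ f) x (b i) (b i) = 0) →
      r ^ Module.finrank ℝ V * |f z| ^ p ≤ C * ∫ y in Metric.ball z r, |f y| ^ p ∂μ := by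
  set A := ∫ y, radialBump b 2 y ∂μ with hA
  have hA0 : 0 < A := integral_radialBump_pos hb two_ne_zero
  set d := Module.finrank ℝ V with hd
  have hd0 : (0 : ℝ) < d := by exact_mod_cast Module.finrank_pos
  refine ⟨2 ^ (d / p) / A, by positivity, fun f z r hr hf h => ?_⟩
  have hfc : ContinuousOn f (Metric.closedBall z r) :=
    hf.continuousOn.mono (Metric.closedBall_subset_ball (by linarith))
  set I := ∫ y in Metric.ball z r, |f y| ^ p ∂μ
  have hI : 0 ≤ I := setIntegral_nonneg measurableSet_ball fun y _ => by positivity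
  have hdp : 0 < d / p := by positivity
  have hpow {a : ℝ} (ha : 0 ≤ a) : (a ^ (d / p : ℝ)) ^ p = a ^ d := by
    rw [← Real.rpow_mul ha, div_mul_cancel₀ _ hp.ne', Real.rpow_natCast]
  obtain ⟨x, hx, hmax⟩ := (isCompact_closedBall z r).exists_isMaxOn
    (f := fun x => (r - dist x z) ^ (d / p : ℝ) * |f x|) ⟨z, by simp [hr.le]⟩
    (ContinuousOn.mul (Continuous.continuousOn (by
      refine Continuous.rpow_const (by fun_prop) fun _ => Or.inr hdp.le)) hfc.abs)
  set M := (r - dist x z) ^ (d / p : ℝ) * |f x| with hM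
  have hxr : dist x z ≤ r := hx
  have hM0 : 0 ≤ M := mul_nonneg (Real.rpow_nonneg (by linarith) _) (abs_nonneg _)
  have hz : r ^ (d / p : ℝ) * |f z| ≤ M := by
    have := hmax (show z ∈ Metric.closedBall z r by simp [hr.le])
    simpa using this
  suffices hMI : M ^ p ≤ 2 ^ (d / p : ℝ) / A * I by
    calc r ^ d * |f z| ^ p = (r ^ (d / p : ℝ) * |f z|) ^ p := by
          rw [Real.mul_rpow (by positivity) (abs_nonneg _), hpow hr.le]
      _ ≤ M ^ p := Real.rpow_le_rpow (by positivity) hz hp.le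
      _ ≤ _ := hMI
  rcases hM0.eq_or_lt with h0 | hMpos
  · rw [← h0, Real.zero_rpow hp.ne']; positivity
  have hxlt : dist x z < r := by
    refine lt_of_le_of_ne hxr fun heq => hMpos.ne' ?_
    rw [hM, heq, sub_self, Real.zero_rpow hdp.ne', zero_mul]
  set δ := (r - dist x z) / 2 with hδ
  have hδ0 : 0 < δ := by rw [hδ]; linarith
  have hsub : Metric.ball x (2 * δ) ⊆ Metric.ball z r :=
    Metric.ball_subset_ball' (by rw [hδ]; linarith)
  have hsub2 : Metric.ball x (2 * δ) ⊆ Metric.ball z (2 * r) :=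
    hsub.trans (Metric.ball_subset_ball (by linarith))
  have hsub3 : Metric.ball x δ ⊆ Metric.ball z r :=
    (Metric.ball_subset_ball (by linarith)).trans hsub
  set a := δ ^ (d / p : ℝ) with ha
  have ha0 : 0 < a := by positivity
  have hbound : ∀ y ∈ Metric.ball x δ, |f y| ≤ M / a := by
    intro y hy
    have h1 : (r - dist y z) ^ (d / p : ℝ) * |f y| ≤ M :=
      hmax (Metric.ball_subset_closedBall (hsub3 hy))
    have h2 : δ ≤ r - dist y z := by
      have := dist_triangle y x z
      have := Metric.mem_ball.1 hy
      have : r - dist x z = 2 * δ := by rw [hδ]; ring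
      linarith
    rw [le_div_iff₀ ha0, mul_comm]
    exact (mul_le_mul_of_nonneg_right (Real.rpow_le_rpow hδ0.le h2 hdp.le)
      (abs_nonneg _)).trans h1
  have hmean := mul_abs_le_setIntegral_ball (μ := μ) hb hδ0 (hf.mono hsub2)
    fun y hy => h y (hsub2 hy)
  have hint := integrableOn_abs_rpow_ball (μ := μ) hp.le hfc
  have hle : ∫ y in Metric.ball x δ, |f y| ∂μ ≤ (M / a) ^ (1 - p) * I := by
    calc ∫ y in Metric.ball x δ, |f y| ∂μ
        ≤ ∫ y in Metric.ball x δ, (M / a) ^ (1 - p) * |f y| ^ p ∂μ := by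
          refine setIntegral_mono_on ?_ ((hint.mono_set hsub3).const_mul _) measurableSet_ball
            fun y hy => ?_
          · have := integrableOn_abs_rpow_ball (μ := μ) zero_le_one hfc
            simpa using this.mono_set hsub3
          · calc |f y| = |f y| ^ (1 - p) * |f y| ^ p := by
                  rw [← Real.rpow_add' (abs_nonneg _) (by simp)]; simp
              _ ≤ _ := by
                  gcongr
                  exact hbound y hy
      _ = (M / a) ^ (1 - p) * ∫ y in Metric.ball x δ, |f y| ^ p ∂μ := integral_const_mul _ _
      _ ≤ _ := by
          gcongr
          exact setIntegral_mono_set hint (Filter.Eventually.of_forall fun y => by positivity)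
            hsub3.eventuallyLE
  have hMx : M = 2 ^ (d / p : ℝ) * a * |f x| := by
    rw [hM, ha, ← Real.mul_rpow zero_le_two hδ0.le]
    congr 2; rw [hδ]; ring
  have hmain : A * a ^ p * |f x| ≤ (M / a) ^ (1 - p) * I := by
    rw [ha, hpow hδ0.le]; exact hmean.trans hle
  have hK : (M / a) ^ (p - 1) * (M / a) ^ (1 - p) = 1 := by
    rw [← Real.rpow_add (by positivity)]; simp
  rw [div_mul_eq_mul_div, le_div_iff₀ hA0]
  calc M ^ p * A = 2 ^ (d / p : ℝ) * ((M / a) ^ (p - 1) * (A * a ^ p * |f x|)) := by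
        have h1 : M ^ p = (M / a) ^ (p - 1) * (M / a) * a ^ p := by
          rw [← Real.rpow_add_one (by positivity), sub_add_cancel,
            ← Real.mul_rpow (by positivity) ha0.le, div_mul_cancel₀ _ ha0.ne']
        have h2 : M / a = 2 ^ (d / p : ℝ) * |f x| := by
          rw [hMx]; field_simp
        rw [h1]
        nth_rewrite 2 [h2]
        ring
    _ ≤ 2 ^ (d / p : ℝ) * ((M / a) ^ (p - 1) * ((M / a) ^ (1 - p) * I)) := by gcongr
    _ = _ := by rw [← mul_assoc ((M / a) ^ (p - 1)), hK, one_mul]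

/-- The sub-mean value property of `|f| ^ p` for harmonic `f` and `0 < p < ∞`. -/
lemma exists_rpow_le_setIntegral_ball [Nontrivial V] (hb : ∀ y, ‖y‖ ^ 2 ≤ coordSq b y) {p : ℝ}
    (hp : 0 < p) :
    ∃ C : ℝ, 0 < C ∧ ∀ (f : V → ℝ) (z : V) (r : ℝ), 0 < r →
      ContDiffOn ℝ 2 f (Metric.ball z (2 * r)) →
      (∀ x ∈ Metric.ball z (2 * r), ∑ i, fderiv ℝ (fderiv ℝ f) x (b i) (b i) = 0) →
      ENNReal.ofReal (|f z| ^ p) ≤ ENNReal.ofReal (C / r ^ Module.finrank ℝ V) *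
        ∫⁻ y in Metric.ball z r, ENNReal.ofReal (|f y| ^ p) ∂μ := by
  obtain ⟨C, hC, H⟩ := (lt_or_ge p 1).elim (exists_rpow_le_of_lt_one (μ := μ) hb hp)
    (exists_rpow_le_of_one_le (μ := μ) hb)
  refine ⟨C, hC, fun f z r hr hf h => ?_⟩
  have hfc : ContinuousOn f (Metric.closedBall z r) :=
    hf.continuousOn.mono (Metric.closedBall_subset_ball (by linarith))
  rw [← ofReal_integral_eq_lintegral_ofReal (integrableOn_abs_rpow_ball hp.le hfc)
    (Filter.Eventually.of_forall fun y => by positivity), ← ENNReal.ofReal_mul (by positivity)]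
  refine ENNReal.ofReal_le_ofReal ?_
  rw [div_mul_eq_mul_div, le_div_iff₀ (by positivity), mul_comm]
  exact H f z r hr hf h

end LocalEstimate

section Coordinates

/-- The linear identification of `ℝ^n × ℝ` with `ℝ^{n+1}` given by `pt`. -/
def ptEquiv (n : ℕ) : (Euc n × ℝ) ≃ₗ[ℝ] Euc (n + 1) where
  toFun w := pt w.1 w.2
  invFun z := (xp z, tp z)
  map_add' w w' := by
    ext i
    refine Fin.lastCases ?_ (fun i => ?_) i <;> simp [pt]
  map_smul' c w := by
    ext i
    refine Fin.lastCases ?_ (fun i => ?_) i <;> simp [pt]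
  left_inv w := by
    refine Prod.ext (PiLp.ext fun i => ?_) ?_ <;> simp [pt, xp, tp]
  right_inv z := by
    ext i
    refine Fin.lastCases ?_ (fun i => ?_) i <;> simp [pt, xp, tp]

@[simp] lemma ptEquiv_apply {n : ℕ} (w : Euc n × ℝ) : ptEquiv n w = pt w.1 w.2 := rfl

@[simp] lemma tp_pt {n : ℕ} (x : Euc n) (t : ℝ) : tp (pt x t) = t := by simp [tp, pt]

lemma norm_sq_le_sum_pt {n : ℕ} (w : Euc n × ℝ) : ‖w‖ ^ 2 ≤ ∑ i, pt w.1 w.2 i ^ 2 := by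
  have h : ∑ i, pt w.1 w.2 i ^ 2 = ‖w.1‖ ^ 2 + ‖w.2‖ ^ 2 := by
    rw [Fin.sum_univ_castSucc, EuclideanSpace.norm_sq_eq]
    simp [pt]
  rw [h, Prod.norm_def]
  rcases max_choice ‖w.1‖ ‖w.2‖ with h | h <;> rw [h] <;>
    nlinarith [sq_nonneg ‖w.1‖, sq_nonneg ‖w.2‖]

/-- The linear identification of `(ℝ^n × ℝ)^m` with `(ℝ^{n+1})^m`. -/
def ptPiEquiv (n m : ℕ) : (Fin m → Euc n × ℝ) ≃L[ℝ] (Fin m → Euc (n + 1)) :=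
  (LinearEquiv.piCongrRight fun _ => ptEquiv n).toContinuousLinearEquiv

@[simp] lemma ptPiEquiv_apply {n m : ℕ} (v : Fin m → Euc n × ℝ) (j : Fin m) :
    ptPiEquiv n m v j = pt (v j).1 (v j).2 := rfl

/-- The basis of `(ℝ^n × ℝ)^m` corresponding to the standard basis of `(ℝ^{n+1})^m`. -/
def ptBasis (n m : ℕ) : Module.Basis (Σ _ : Fin m, Fin (n + 1)) ℝ (Fin m → Euc n × ℝ) :=
  (Pi.basis fun _ : Fin m => (EuclideanSpace.basisFun (Fin (n + 1)) ℝ).toBasis).map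
    (ptPiEquiv n m).symm.toLinearEquiv

lemma ptPiEquiv_ptBasis {n m : ℕ} (j : Fin m) (i : Fin (n + 1)) :
    ptPiEquiv n m (ptBasis n m ⟨j, i⟩) =
      Function.update (0 : Fin m → Euc (n + 1)) j (EuclideanSpace.single i 1) := by
  simp [ptBasis, Pi.single]

lemma ptBasis_coord {n m : ℕ} (v : Fin m → Euc n × ℝ) (j : Fin m) (i : Fin (n + 1)) :
    (ptBasis n m).coord ⟨j, i⟩ v = pt (v j).1 (v j).2 i := by
  simp [ptBasis]

lemma norm_sq_le_coordSq_ptBasis {n m : ℕ} (v : Fin m → Euc n × ℝ) :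
    ‖v‖ ^ 2 ≤ coordSq (ptBasis n m) v := by
  have h0 := coordSq_nonneg (ptBasis n m) v
  rw [← Real.le_sqrt (norm_nonneg _) h0, pi_norm_le_iff_of_nonneg (Real.sqrt_nonneg _)]
  intro j
  rw [Real.le_sqrt (norm_nonneg _) h0]
  refine (norm_sq_le_sum_pt (v j)).trans ?_
  simp only [coordSq, LinearMap.coe_toContinuousLinearMap', Fintype.sum_sigma, ptBasis_coord]
  exact Finset.single_le_sum (f := fun j => ∑ i, pt (v j).1 (v j).2 i ^ 2)
    (fun j _ => Finset.sum_nonneg fun i _ => sq_nonneg _) (Finset.mem_univ j)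

lemma HarmonicOnM.contDiffOn_comp {n m : ℕ} {f : (Fin m → Euc (n + 1)) → ℝ} (hf : HarmonicOnM f) :
    ContDiffOn ℝ 2 (f ∘ ptPiEquiv n m) {v | ∀ j, 0 < (v j).2} :=
  hf.1.comp (ptPiEquiv n m).contDiff.contDiffOn fun v hv j => by simpa [upperHS] using hv j

lemma HarmonicOnM.laplacian_comp {n m : ℕ} {f : (Fin m → Euc (n + 1)) → ℝ} (hf : HarmonicOnM f)
    {v : Fin m → Euc n × ℝ} (hv : ∀ j, 0 < (v j).2) :
    ∑ k, fderiv ℝ (fderiv ℝ (f ∘ ptPiEquiv n m)) v (ptBasis n m k) (ptBasis n m k) = 0 := by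
  rw [← hf.2 (ptPiEquiv n m v) fun j => by simpa [upperHS] using hv j, Fintype.sum_sigma]
  refine Finset.sum_congr rfl fun j _ => Finset.sum_congr rfl fun i _ => ?_
  have h := (ptPiEquiv n m).iteratedFDerivWithin_comp_right f uniqueDiffOn_univ
    (mem_univ (ptPiEquiv n m v)) 2
  rw [preimage_univ, iteratedFDerivWithin_univ, iteratedFDerivWithin_univ] at h
  have h2 := iteratedFDeriv_two_apply (𝕜 := ℝ) (f ∘ ptPiEquiv n m) v
    ![ptBasis n m ⟨j, i⟩, ptBasis n m ⟨j, i⟩]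
  rw [h] at h2
  simp only [Matrix.cons_val_zero, Matrix.cons_val_one] at h2
  rw [← h2, d2, ContinuousMultilinearMap.compContinuousLinearMap_apply]
  congr 1
  funext k
  fin_cases k <;> exact ptPiEquiv_ptBasis j i

end Coordinates

section Measures

lemma smul_pi_le_pi {ι : Type*} [Fintype ι] {α : ι → Type*} [∀ i, MeasurableSpace (α i)]
    {μ ν : ∀ i, Measure (α i)} [∀ i, SigmaFinite (μ i)] (c : ι → ℝ≥0∞)
    (h : ∀ i, c i • μ i ≤ ν i) : (∏ i, c i) • Measure.pi μ ≤ Measure.pi ν := by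
  refine Measure.le_iff.2 fun s hs => ?_
  have hle : ((∏ i, c i) • Measure.pi μ).toOuterMeasure ≤
      OuterMeasure.pi fun i => (ν i).toOuterMeasure := by
    refine OuterMeasure.le_pi.2 fun t _ => ?_
    simp only [Measure.coe_toOuterMeasure, Measure.smul_apply, Measure.pi_pi, smul_eq_mul,
      ← Finset.prod_mul_distrib]
    exact Finset.prod_le_prod' fun i _ => h i (t i)
  have hpi : Measure.pi ν s = OuterMeasure.pi (fun i => (ν i).toOuterMeasure) s := by
    rw [Measure.pi, toMeasure_apply _ _ hs]
  rw [hpi]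
  exact hle s

instance {n : ℕ} {l : ℝ} : SigmaFinite (mLam n l) := by
  unfold mLam; infer_instance

instance {n : ℕ} : (volume : Measure (Euc n × ℝ)).IsAddHaarMeasure :=
  inferInstanceAs ((volume : Measure (Euc n)).prod (volume : Measure ℝ)).IsAddHaarMeasure

instance {n m : ℕ} : (volume : Measure (Fin m → Euc n × ℝ)).IsAddHaarMeasure :=
  Measure.pi.isAddHaarMeasure fun _ : Fin m => (volume : Measure (Euc n × ℝ))

lemma mLam_eq (n : ℕ) (l : ℝ) : mLam n l =
    ((volume : Measure (Euc n × ℝ)).restrict (univ ×ˢ Ioi 0)).withDensity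
      fun w => ENNReal.ofReal (w.2 ^ l) := by
  rw [mLam, Measure.volume_eq_prod, ← Measure.prod_restrict, Measure.restrict_univ]

lemma min_rpow_mul_rpow_le {t τ : ℝ} (s : ℝ) (ht : 0 < t) (h1 : t / 2 ≤ τ) (h2 : τ ≤ 3 / 2 * t) :
    min ((1 / 2 : ℝ) ^ s) ((3 / 2) ^ s) * t ^ s ≤ τ ^ s := by
  have hτ : 0 < τ := by linarith
  rcases le_total 0 s with hs | hs
  · refine (mul_le_mul_of_nonneg_right (min_le_left _ _) (by positivity)).trans ?_
    rw [← Real.mul_rpow (by norm_num) ht.le]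
    exact Real.rpow_le_rpow (by positivity) (by linarith) hs
  · refine (mul_le_mul_of_nonneg_right (min_le_right _ _) (by positivity)).trans ?_
    rw [← Real.mul_rpow (by norm_num) ht.le]
    exact Real.rpow_le_rpow_of_nonpos hτ h2 hs

lemma snd_mem_of_mem_ball {n : ℕ} {w w' : Euc n × ℝ} (h : w' ∈ Metric.ball w (w.2 / 2)) :
    w.2 / 2 < w'.2 ∧ w'.2 < 3 / 2 * w.2 := by
  have h1 : dist w'.2 w.2 < w.2 / 2 := lt_of_le_of_lt (le_max_right _ _) h
  rw [Real.dist_eq, abs_lt] at h1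
  constructor <;> linarith [h1.1, h1.2]

lemma smul_restrict_ball_le_mLam {n : ℕ} (s : ℝ) {w : Euc n × ℝ} (hw : 0 < w.2) :
    ENNReal.ofReal (min ((1 / 2 : ℝ) ^ s) ((3 / 2) ^ s) * w.2 ^ s) •
      (volume : Measure (Euc n × ℝ)).restrict (Metric.ball w (w.2 / 2)) ≤
      (mLam n s).restrict (Metric.ball w (w.2 / 2)) := by
  refine Measure.le_iff.2 fun A hA => ?_
  have hB : MeasurableSet (A ∩ Metric.ball w (w.2 / 2)) := hA.inter measurableSet_ball
  have hsub : A ∩ Metric.ball w (w.2 / 2) ⊆ univ ×ˢ Ioi 0 := fun w' hw' =>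
    ⟨mem_univ _, by have := (snd_mem_of_mem_ball hw'.2).1; simp only [mem_Ioi]; linarith⟩
  rw [Measure.smul_apply, Measure.restrict_apply hA, Measure.restrict_apply hA, mLam_eq,
    withDensity_apply _ hB, Measure.restrict_restrict hB, inter_eq_left.2 hsub, smul_eq_mul,
    ← setLIntegral_const]
  refine setLIntegral_mono' hB fun w' hw' => ENNReal.ofReal_le_ofReal ?_
  have := snd_mem_of_mem_ball hw'.2
  exact min_rpow_mul_rpow_le s hw this.1.le this.2.le

lemma setLIntegral_ball_le_pi_mLam {n m : ℕ} (s : Fin m → ℝ) :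
    ∃ c : ℝ, 0 < c ∧ ∀ (F : (Fin m → Euc n × ℝ) → ℝ≥0∞) (w : Euc n × ℝ), 0 < w.2 →
      ∫⁻ v in Metric.ball (fun _ => w) (w.2 / 2), F v ≤ ENNReal.ofReal (c * w.2 ^ (-∑ j, s j)) *
        ∫⁻ v in Metric.ball (fun _ => w) (w.2 / 2), F v ∂(Measure.pi fun j => mLam n (s j)) := by
  set k : Fin m → ℝ := fun j => min ((1 / 2 : ℝ) ^ s j) ((3 / 2) ^ s j)
  have hk (j : Fin m) : 0 < k j := lt_min (by positivity) (by positivity)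
  have hK : 0 < ∏ j, k j := Finset.prod_pos fun j _ => hk j
  refine ⟨(∏ j, k j)⁻¹, by positivity, fun F w hw => ?_⟩
  have hpi := smul_pi_le_pi (μ := fun _ : Fin m => volume.restrict (Metric.ball w (w.2 / 2)))
    _ fun j => smul_restrict_ball_le_mLam (s j) hw
  rw [← Measure.restrict_pi_pi, ← Measure.restrict_pi_pi, ← ball_pi _ (by positivity), ← volume_pi,
    ← ENNReal.ofReal_prod_of_nonneg fun j _ => (mul_pos (hk j) (by positivity)).le,
    Finset.prod_mul_distrib, ← Real.rpow_sum_of_pos hw] at hpi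
  have hle := lintegral_mono' hpi (le_refl F)
  rw [lintegral_smul_measure, smul_eq_mul] at hle
  calc ∫⁻ v in Metric.ball (fun _ => w) (w.2 / 2), F v
      = ENNReal.ofReal ((∏ j, k j)⁻¹ * w.2 ^ (-∑ j, s j)) *
        (ENNReal.ofReal ((∏ j, k j) * w.2 ^ (∑ j, s j)) *
          ∫⁻ v in Metric.ball (fun _ => w) (w.2 / 2), F v) := by
        rw [← mul_assoc, ← ENNReal.ofReal_mul (by positivity), mul_mul_mul_comm,
          inv_mul_cancel₀ hK.ne', ← Real.rpow_add hw]
        simp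
    _ ≤ _ := by gcongr

lemma lintegral_mem_ball_le {n : ℕ} {w' : Euc n × ℝ} (hw' : 0 < w'.2) :
    ∫⁻ w in univ ×ˢ Ioi 0, ENNReal.ofReal (w.2 ^ (-((n : ℝ) + 1))) *
        {w : Euc n × ℝ | w' ∈ Metric.ball w (w.2 / 2)}.indicator 1 w ≤
      ENNReal.ofReal ((3 / 2) ^ (n + 1)) * volume (Metric.ball (0 : Euc n × ℝ) 1) := by
  calc ∫⁻ w in univ ×ˢ Ioi 0, ENNReal.ofReal (w.2 ^ (-((n : ℝ) + 1))) *
        {w : Euc n × ℝ | w' ∈ Metric.ball w (w.2 / 2)}.indicator 1 w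
      ≤ ∫⁻ w : Euc n × ℝ, (Metric.ball w' w'.2).indicator
          (fun _ => ENNReal.ofReal ((3 / (2 * w'.2)) ^ (n + 1))) w := by
        refine (setLIntegral_le_lintegral _ _).trans (lintegral_mono fun w => ?_)
        by_cases hw : w' ∈ Metric.ball w (w.2 / 2)
        · have h := snd_mem_of_mem_ball hw
          have hw0 : 0 < w.2 := by linarith
          have hmem : w ∈ Metric.ball w' w'.2 := by
            rw [Metric.mem_ball, dist_comm]
            exact (Metric.mem_ball.1 hw).trans h.1
          rw [indicator_of_mem (by exact hw), indicator_of_mem hmem, Pi.one_apply, mul_one]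
          refine ENNReal.ofReal_le_ofReal ?_
          rw [Real.rpow_neg hw0.le, ← Real.inv_rpow hw0.le]
          norm_cast
          refine pow_le_pow_left₀ (by positivity) ?_ _
          rw [inv_eq_one_div, div_le_div_iff₀ hw0 (by positivity)]
          linarith
        · rw [indicator_of_notMem (by exact hw)]; simp
    _ = _ := by
        rw [lintegral_indicator_const measurableSet_ball, Measure.addHaar_ball_of_pos _ _ hw',
          ← mul_assoc, ← ENNReal.ofReal_mul (by positivity)]
        simp only [Module.finrank_prod, finrank_euclideanSpace, Fintype.card_fin,
          Module.finrank_self]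
        rw [← mul_pow]
        congr 3
        field_simp

end Measures

section DiagonalRestriction

/-- The ball in `(ℝ^n × ℝ)^m` around a diagonal point with radius half its height. -/
def diagBall {n : ℕ} (m : ℕ) (w : Euc n × ℝ) : Set (Fin m → Euc n × ℝ) :=
  Metric.ball (fun _ => w) (w.2 / 2)

lemma snd_pos_of_mem_ball {n m : ℕ} {w : Euc n × ℝ} {v : Fin m → Euc n × ℝ}
    (hv : v ∈ Metric.ball (fun _ => w) w.2) (j : Fin m) : 0 < (v j).2 := by
  have h0 : 0 < w.2 := Metric.pos_of_mem_ball hv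
  have h1 : dist (v j) w < w.2 := (dist_pi_lt_iff h0).1 hv j
  have h2 : dist (v j).2 w.2 < w.2 := lt_of_le_of_lt (le_max_right _ _) h1
  rw [Real.dist_eq, abs_lt] at h2
  linarith [h2.1]

lemma measurableSet_diagBall {n m : ℕ} :
    MeasurableSet {q : (Euc n × ℝ) × (Fin m → Euc n × ℝ) | q.2 ∈ diagBall m q.1} := by
  refine IsOpen.measurableSet ?_
  have : {q : (Euc n × ℝ) × (Fin m → Euc n × ℝ) | q.2 ∈ diagBall m q.1} =
      {q | dist q.2 (fun _ => q.1) < q.1.2 / 2} := rfl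
  rw [this]
  exact isOpen_lt (by fun_prop) (by fun_prop)

lemma HarmonicOnM.exists_rpow_le_setLIntegral_diagBall {n m : ℕ} (hm : 1 ≤ m) {p : ℝ} (hp : 0 < p)
    (s : Fin m → ℝ) : ∃ C : ℝ, 0 < C ∧ ∀ f : (Fin m → Euc (n + 1)) → ℝ, HarmonicOnM f →
      ∀ w : Euc n × ℝ, 0 < w.2 →
        ENNReal.ofReal (w.2 ^ (((m : ℝ) - 1) * ((n : ℝ) + 1) + ∑ j, s j)) *
          ENNReal.ofReal (|f (fun _ => pt w.1 w.2)| ^ p) ≤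
        ENNReal.ofReal C * (ENNReal.ofReal (w.2 ^ (-((n : ℝ) + 1))) *
          ∫⁻ v in diagBall m w, ENNReal.ofReal (|f (fun j => pt (v j).1 (v j).2)| ^ p)
            ∂(Measure.pi fun j => mLam n (s j))) := by
  have : Nonempty (Fin m) := ⟨⟨0, hm⟩⟩
  have : Nontrivial (Fin m → Euc n × ℝ) := inferInstance
  obtain ⟨C, hC, hmean⟩ := exists_rpow_le_setIntegral_ball
    (μ := (volume : Measure (Fin m → Euc n × ℝ))) (b := ptBasis n m)
    norm_sq_le_coordSq_ptBasis hp
  obtain ⟨c, hc, hle⟩ := setLIntegral_ball_le_pi_mLam (n := n) s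
  have hd : Module.finrank ℝ (Fin m → Euc n × ℝ) = m * (n + 1) := by
    rw [Module.finrank_pi_fintype]
    simp
  refine ⟨C * c * 2 ^ (m * (n + 1)), by positivity, fun f hf w hw => ?_⟩
  have h2 : 2 * (w.2 / 2) = w.2 := by ring
  have hsub : Metric.ball (fun _ => w) (2 * (w.2 / 2)) ⊆
      {v : Fin m → Euc n × ℝ | ∀ j, 0 < (v j).2} := by
    rw [h2]
    exact fun v hv j => snd_pos_of_mem_ball hv j
  have h := hmean (f ∘ ptPiEquiv n m) (fun _ => w) (w.2 / 2) (by positivity)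
    (hf.contDiffOn_comp.mono hsub) fun v hv => hf.laplacian_comp (hsub hv)
  have hcst : w.2 ^ (((m : ℝ) - 1) * ((n : ℝ) + 1) + ∑ j, s j) *
      (C / (w.2 / 2) ^ (m * (n + 1)) * (c * w.2 ^ (-∑ j, s j))) =
      C * c * 2 ^ (m * (n + 1)) * w.2 ^ (-((n : ℝ) + 1)) := by
    have hexp : w.2 ^ (((m : ℝ) - 1) * ((n : ℝ) + 1) + ∑ j, s j) =
        w.2 ^ (-((n : ℝ) + 1)) * w.2 ^ (m * (n + 1)) * w.2 ^ (∑ j, s j) := by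
      rw [← Real.rpow_natCast, ← Real.rpow_add hw, ← Real.rpow_add hw]
      congr 1
      push_cast
      ring
    rw [hexp, Real.rpow_neg hw.le (∑ j, s j), div_pow]
    field_simp
  rw [hd] at h
  refine (mul_le_mul_right (h.trans (mul_le_mul_right (hle _ w hw) _)) _).trans_eq ?_
  rw [← mul_assoc, ← mul_assoc, ← mul_assoc, ← ENNReal.ofReal_mul (by positivity),
    ← ENNReal.ofReal_mul (by positivity), ← ENNReal.ofReal_mul (by positivity), mul_assoc, hcst]
  rfl

lemma setLIntegral_diagBall_le {n m : ℕ} (hm : 1 ≤ m) (ν : Measure (Fin m → Euc n × ℝ)) [SFinite ν]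
    {G : (Fin m → Euc n × ℝ) → ℝ≥0∞} (hG : Measurable G)
    (hG0 : ∀ v, G v ≠ 0 → ∀ j, 0 < (v j).2) :
    ∫⁻ w in univ ×ˢ Ioi 0, ENNReal.ofReal (w.2 ^ (-((n : ℝ) + 1))) *
        ∫⁻ v in diagBall m w, G v ∂ν ≤
      ENNReal.ofReal ((3 / 2) ^ (n + 1)) * volume (Metric.ball (0 : Euc n × ℝ) 1) *
        ∫⁻ v, G v ∂ν := by
  have hD (w : Euc n × ℝ) : MeasurableSet (diagBall m w) := measurableSet_ball
  have hρ : Measurable fun w : Euc n × ℝ => ENNReal.ofReal (w.2 ^ (-((n : ℝ) + 1))) := by fun_prop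
  have hmeas : Measurable fun q : (Euc n × ℝ) × (Fin m → Euc n × ℝ) =>
      ENNReal.ofReal (q.1.2 ^ (-((n : ℝ) + 1))) *
        {q : (Euc n × ℝ) × (Fin m → Euc n × ℝ) | q.2 ∈ diagBall m q.1}.indicator
          (fun q => G q.2) q :=
    (hρ.comp measurable_fst).mul ((hG.comp measurable_snd).indicator measurableSet_diagBall)
  calc _ = ∫⁻ w in univ ×ˢ Ioi 0, ∫⁻ v, ENNReal.ofReal (w.2 ^ (-((n : ℝ) + 1))) *
        (diagBall m w).indicator G v ∂ν := by
        refine lintegral_congr fun w => ?_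
        rw [lintegral_const_mul _ (hG.indicator (hD w)), lintegral_indicator (hD w)]
    _ = ∫⁻ v, (∫⁻ w in univ ×ˢ Ioi 0, ENNReal.ofReal (w.2 ^ (-((n : ℝ) + 1))) *
        (diagBall m w).indicator G v) ∂ν := lintegral_lintegral_swap hmeas.aemeasurable
    _ ≤ ∫⁻ v, ENNReal.ofReal ((3 / 2) ^ (n + 1)) * volume (Metric.ball (0 : Euc n × ℝ) 1) *
        G v ∂ν := by
        refine lintegral_mono fun v => ?_
        by_cases hv : G v = 0
        · have h0 (w : Euc n × ℝ) : (diagBall m w).indicator G v = 0 := by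
            by_cases hw : v ∈ diagBall m w <;> simp [hw, hv]
          simp [h0]
        have hj := lintegral_mem_ball_le (hG0 v hv ⟨0, hm⟩)
        refine le_trans ?_ (mul_le_mul_left hj (G v))
        rw [← lintegral_mul_const]
        · refine lintegral_mono fun w => ?_
          rw [mul_assoc]
          refine mul_le_mul_right ?_ _
          by_cases hw : v ∈ diagBall m w
          · have hw2 : v ⟨0, hm⟩ ∈ Metric.ball w (w.2 / 2) :=
              (dist_pi_lt_iff (Metric.pos_of_mem_ball hw)).1 hw _
            rw [indicator_of_mem hw, indicator_of_mem (by exact hw2), Pi.one_apply, one_mul]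
          · rw [indicator_of_notMem hw]
            exact zero_le
        · refine hρ.mul (measurable_one.indicator (IsOpen.measurableSet ?_))
          exact isOpen_lt (f := fun w : Euc n × ℝ => dist (v ⟨0, hm⟩) w) (by fun_prop)
            (by fun_prop)
    _ = _ := lintegral_const_mul _ hG

end DiagonalRestriction

/-- the diagonal restriction inequality for harmonic functions on the
polydomain (ℝ^{n+1}_+)^m. -/
theorem stmt7 (n m : ℕ) (hn : 1 ≤ n) (hm : 1 ≤ m) (p : ℝ) (hp : 0 < p)
    (s : Fin m → ℝ) (hs : ∀ j, -1 < s j)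
    (lam : ℝ) (hlam : lam = ((m : ℝ) - 1) * ((n : ℝ) + 1) + ∑ j, s j) :
    ∃ C : ℝ, 0 < C ∧ ∀ f : (Fin m → Euc (n + 1)) → ℝ, HarmonicOnM f →
      (∫⁻ zt : Euc n × ℝ, ENNReal.ofReal (|f (fun _ => pt zt.1 zt.2)| ^ p) ∂(mLam n lam)) ≤
        ENNReal.ofReal C *
          ∫⁻ z : Fin m → (Euc n × ℝ),
            ENNReal.ofReal (|f (fun j => pt (z j).1 (z j).2)| ^ p)
            ∂(Measure.pi fun j => mLam n (s j)) := by
  obtain ⟨C, hC, hloc⟩ := HarmonicOnM.exists_rpow_le_setLIntegral_diagBall (n := n) hm hp s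
  have hvol : 0 < (volume (Metric.ball (0 : Euc n × ℝ) 1)).toReal :=
    ENNReal.toReal_pos (Metric.measure_ball_pos _ _ one_pos).ne' measure_ball_lt_top.ne
  refine ⟨C * ((3 / 2) ^ (n + 1) * (volume (Metric.ball (0 : Euc n × ℝ) 1)).toReal),
    by positivity, fun f hf => ?_⟩
  set F : (Fin m → Euc n × ℝ) → ℝ≥0∞ :=
    fun v => ENNReal.ofReal (|f (fun j => pt (v j).1 (v j).2)| ^ p)
  set U : Set (Fin m → Euc n × ℝ) := {v | ∀ j, 0 < (v j).2}
  have hU : MeasurableSet U := by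
    simp only [U, ofPred_forall]
    exact MeasurableSet.iInter fun j => measurableSet_lt measurable_const (by fun_prop)
  have hG : Measurable (U.indicator F) := by
    refine measurable_of_restrict_of_restrict_compl hU ?_ ?_
    · have hres : U.domRestrict (U.indicator F) = U.domRestrict F :=
        funext fun v => indicator_of_mem v.2 F
      rw [hres]
      have hcont := hf.contDiffOn_comp.continuousOn.domRestrict.measurable
      exact (hcont.abs.pow_const p).ennreal_ofReal
    · have hres : Uᶜ.domRestrict (U.indicator F) = fun _ => 0 :=
        funext fun v => indicator_of_notMem v.2 F
      rw [hres]
      exact measurable_const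
  have hdens : Measurable fun w : Euc n × ℝ => ENNReal.ofReal (w.2 ^ lam) := by fun_prop
  rw [mLam_eq]
  refine (lintegral_withDensity_le_lintegral_mul _ hdens _).trans ?_
  calc _ ≤ ∫⁻ w in univ ×ˢ Ioi 0, ENNReal.ofReal C * (ENNReal.ofReal (w.2 ^ (-((n : ℝ) + 1))) *
        ∫⁻ v in diagBall m w, U.indicator F v ∂(Measure.pi fun j => mLam n (s j))) := by
        refine setLIntegral_mono' (MeasurableSet.univ.prod measurableSet_Ioi) fun w hw => ?_
        have hw0 : 0 < w.2 := hw.2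
        have heq : ∫⁻ v in diagBall m w, U.indicator F v ∂(Measure.pi fun j => mLam n (s j)) =
            ∫⁻ v in diagBall m w, F v ∂(Measure.pi fun j => mLam n (s j)) := by
          refine setLIntegral_congr_fun measurableSet_ball fun v hv => indicator_of_mem ?_ _
          exact fun j => snd_pos_of_mem_ball (Metric.ball_subset_ball (by linarith) hv) j
        rw [heq, Pi.mul_apply, hlam]
        exact hloc f hf w hw0
    _ = ENNReal.ofReal C * ∫⁻ w in univ ×ˢ Ioi 0, ENNReal.ofReal (w.2 ^ (-((n : ℝ) + 1))) *
        ∫⁻ v in diagBall m w, U.indicator F v ∂(Measure.pi fun j => mLam n (s j)) :=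
        lintegral_const_mul' _ _ ENNReal.ofReal_ne_top
    _ ≤ ENNReal.ofReal C * (ENNReal.ofReal ((3 / 2) ^ (n + 1)) *
        volume (Metric.ball (0 : Euc n × ℝ) 1) *
          ∫⁻ v, U.indicator F v ∂(Measure.pi fun j => mLam n (s j))) := by
        refine mul_le_mul_right (setLIntegral_diagBall_le hm _ hG fun v hv => ?_) _
        by_contra hvU
        exact hv (indicator_of_notMem (by exact hvU) _)
    _ ≤ ENNReal.ofReal C * (ENNReal.ofReal ((3 / 2) ^ (n + 1)) *
        volume (Metric.ball (0 : Euc n × ℝ) 1) * ∫⁻ v, F v ∂(Measure.pi fun j => mLam n (s j))) := by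
        gcongr
        exact indicator_le_self U F _
    _ = _ := by
        rw [ENNReal.ofReal_mul hC.le, ENNReal.ofReal_mul (by positivity),
          ENNReal.ofReal_toReal measure_ball_lt_top.ne, mul_assoc (ENNReal.ofReal C)]

end
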